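/- arXiv:2603.27319 — 8 statements merged into one kernel-verified Lean document; each statement's English description precedes it below -/
import Mathlib

section
/- Let N ≥ 1 be an integer, l ∈ ℤ, and τ ∈ ℂ with Im τ > 0. Define ψ(x,y) := exp(iπNτy²)·θ_{l/N}(N(x+τy), Nτ) for x,y ∈ ℝ. Then for all integers a, b and all x, y ∈ ℝ, ψ(x+a, y+b) = exp(−2πiNbx)·ψ(x,y). (That is, the lowest-Landau-level wavefunctions in the Landau gauge are quasi-periodic with respect to the lattice ℤ ⊕ τℤ with unitary multipliers ẽ_{a+bτ}(x,y) = exp(−2πiNbx).) -/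
open scoped BigOperators

/-- Theta function with characteristic `a`:
`θ_a(w,σ) = Σ_{n∈ℤ} exp(iπσ(n+a)² + 2πi(n+a)w)`. -/
noncomputable def jtheta (a : ℝ) (w σ : ℂ) : ℂ :=
  ∑' n : ℤ, Complex.exp (Real.pi * Complex.I * σ * ((n : ℂ) + (a : ℂ)) ^ 2 +
    2 * Real.pi * Complex.I * ((n : ℂ) + (a : ℂ)) * w)

/-- The lowest-Landau-level wavefunction `ψ(x,y) = e^{iπNτy²} θ_{l/N}(N(x+τy), Nτ)`
is quasi-periodic for the lattice `ℤ ⊕ τℤ` with unitary multipliers `e^{-2πiNbx}`. -/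
theorem stmt_0 (N : ℕ) (hN : 1 ≤ N) (l : ℤ) (τ : ℂ) (hτ : 0 < τ.im)
    (ψ : ℝ → ℝ → ℂ)
    (hψ : ∀ x y : ℝ, ψ x y =
      Complex.exp (Real.pi * Complex.I * (N : ℂ) * τ * (y : ℂ) ^ 2) *
        jtheta ((l : ℝ) / (N : ℝ)) ((N : ℂ) * ((x : ℂ) + τ * (y : ℂ))) ((N : ℂ) * τ)) :
    ∀ (a b : ℤ) (x y : ℝ),
      ψ (x + a) (y + b) =
        Complex.exp (-2 * Real.pi * Complex.I * (N : ℂ) * (b : ℂ) * (x : ℂ)) * ψ x y := by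
  intro a b x y
  have hN0 : (N : ℂ) ≠ 0 := by
    have : N ≠ 0 := by omega
    exact_mod_cast this
  rw [hψ, hψ]
  unfold jtheta
  rw [← tsum_mul_left, ← tsum_mul_left, ← tsum_mul_left, ← (Equiv.subRight b).tsum_eq]
  refine tsum_congr fun n => ?_
  rw [← Complex.exp_add, ← Complex.exp_add, ← Complex.exp_add, Complex.exp_eq_exp_iff_exists_int]
  refine ⟨(N * (n - b) + l) * a, ?_⟩
  simp only [Equiv.subRight_apply]
  push_cast
  field_simp
  ring
end

section
/- Let N ≥ 1 be an integer and τ ∈ ℂ with Im τ > 0. For l ∈ {0,…,N−1} define ψ^{(l)}(x,y) := exp(iπNτy²)·θ_{l/N}(N(x+τy), Nτ). Then for all l, l' ∈ {0,…,N−1} with l ≠ l', the functions are orthogonal on the fundamental domain: ∫₀¹∫₀¹ ψ^{(l)}(x,y)·conj(ψ^{(l')}(x,y)) dx dy = 0. -/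
open scoped BigOperators

theorem jtheta_shift (a : ℝ) (w σ : ℂ) (k : ℕ) :
    jtheta a (w + k) σ = Complex.exp (2 * Real.pi * Complex.I * a * k) * jtheta a w σ := by
  unfold jtheta
  rw [← tsum_mul_left]
  congr 1
  ext n
  rw [← Complex.exp_add]
  refine Complex.exp_eq_exp_iff_exists_int.mpr ⟨n * k, ?_⟩
  push_cast
  ring

/-- Distinct lowest-Landau-level wavefunctions `ψ^{(l)}`, `l = 0,…,N−1`, are
orthogonal on the fundamental domain `[0,1] × [0,1]`. -/
theorem stmt_1 (N : ℕ) (hN : 1 ≤ N) (τ : ℂ) (hτ : 0 < τ.im)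
    (ψ : ℕ → ℝ → ℝ → ℂ)
    (hψ : ∀ (m : ℕ) (x y : ℝ), ψ m x y =
      Complex.exp (Real.pi * Complex.I * (N : ℂ) * τ * (y : ℂ) ^ 2) *
        jtheta ((m : ℝ) / (N : ℝ)) ((N : ℂ) * ((x : ℂ) + τ * (y : ℂ))) ((N : ℂ) * τ)) :
    ∀ l l' : ℕ, l < N → l' < N → l ≠ l' →
      (∫ y in (0:ℝ)..1, ∫ x in (0:ℝ)..1, ψ l x y * (starRingEnd ℂ) (ψ l' x y)) = 0 := by
  intro l l' hl hl' hne
  have hN0 : (N : ℂ) ≠ 0 := by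
    exact_mod_cast (by omega : N ≠ 0)
  have hshift : ∀ (m k : ℕ) (x y : ℝ), ψ m (x + k / N) y =
      Complex.exp (2 * Real.pi * Complex.I * m * k / N) * ψ m x y := by
    intro m k x y
    rw [hψ, hψ]
    have e : (N : ℂ) * (((x + k / N : ℝ) : ℂ) + τ * (y : ℂ)) =
        (N : ℂ) * ((x : ℂ) + τ * (y : ℂ)) + k := by
      push_cast
      field_simp
      ring
    rw [e, jtheta_shift]
    have e2 : 2 * (Real.pi : ℂ) * Complex.I * ((m / N : ℝ) : ℂ) * k =
        2 * Real.pi * Complex.I * m * k / N := by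
      push_cast
      ring
    rw [e2]
    ring
  have hf : ∀ (k : ℕ) (x y : ℝ), ψ l (x + k / N) y * (starRingEnd ℂ) (ψ l' (x + k / N) y) =
      Complex.exp (2 * Real.pi * Complex.I * ((l : ℂ) - l') * k / N) *
        (ψ l x y * (starRingEnd ℂ) (ψ l' x y)) := by
    intro k x y
    rw [hshift, hshift, map_mul, ← Complex.exp_conj]
    have e : Complex.exp (2 * Real.pi * Complex.I * ((l : ℂ) - l') * k / N) =
        Complex.exp (2 * Real.pi * Complex.I * l * k / N) *
        Complex.exp ((starRingEnd ℂ) (2 * Real.pi * Complex.I * l' * k / N)) := by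
      rw [← Complex.exp_add]
      congr 1
      have e3 : (starRingEnd ℂ) (2 : ℂ) = 2 := Complex.conj_ofNat 2
      simp [e3]
      ring
    rw [e]
    ring
  have hω : Complex.exp (2 * Real.pi * Complex.I * ((l : ℂ) - l') * (1 : ℕ) / N) ≠ 1 := by
    intro h
    obtain ⟨n, hn⟩ := Complex.exp_eq_one_iff.mp h
    have hpi := Complex.two_pi_I_ne_zero
    have h1 : 2 * (Real.pi : ℂ) * Complex.I * ((l : ℂ) - l') =
        2 * (Real.pi : ℂ) * Complex.I * (n * N) := by
      rw [div_eq_iff hN0] at hn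
      push_cast at hn
      linear_combination hn
    have h2 := mul_left_cancel₀ hpi h1
    have h3 : (l : ℤ) - l' = n * N := by exact_mod_cast h2
    have h4 : (N : ℤ) ∣ (l : ℤ) - l' := ⟨n, by rw [h3]; ring⟩
    have h5 := Int.eq_zero_of_abs_lt_dvd h4 (by rw [abs_lt]; constructor <;> omega)
    omega
  have hinner : ∀ y : ℝ, (∫ x in (0:ℝ)..1, ψ l x y * (starRingEnd ℂ) (ψ l' x y)) = 0 := by
    intro y
    set f : ℝ → ℂ := fun x => ψ l x y * (starRingEnd ℂ) (ψ l' x y) with hfdef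
    have hper : Function.Periodic f 1 := by
      intro x
      have h := hf N x y
      have e : ((N : ℝ) / N) = 1 := div_self (by exact_mod_cast hN0)
      rw [e] at h
      have e2 : Complex.exp (2 * Real.pi * Complex.I * ((l : ℂ) - l') * N / N) = 1 := by
        refine Complex.exp_eq_one_iff.mpr ⟨(l : ℤ) - l', ?_⟩
        push_cast
        field_simp
      rw [e2, one_mul] at h
      exact h
    have h1 : (∫ x in (0:ℝ)..1, f (x + (1 : ℕ) / N)) = ∫ x in (0:ℝ)..1, f x := by
      rw [intervalIntegral.integral_comp_add_right]
      have := hper.intervalIntegral_add_eq (0 + ((1 : ℕ) : ℝ) / N) 0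
      rw [zero_add (1 : ℝ)] at this
      rw [← this]
      congr 1
      ring
    have h2 : (∫ x in (0:ℝ)..1, f (x + (1 : ℕ) / N)) =
        Complex.exp (2 * Real.pi * Complex.I * ((l : ℂ) - l') * (1 : ℕ) / N) *
          ∫ x in (0:ℝ)..1, f x := by
      rw [← intervalIntegral.integral_const_mul]
      congr 1
      ext x
      exact hf 1 x y
    rw [h1] at h2
    by_contra h0
    exact hω (mul_right_cancel₀ h0 (by rw [one_mul]; exact h2.symm))
  simp [hinner]
end

section
/- Let N ≥ 1 be an integer, l ∈ ℤ, τ ∈ ℂ with Im τ > 0, and s > 0. Set σ := s/(2πN)², τ_s := τ + is/(2πN), and for x,y ∈ ℝ set z_s := x + τ_s·y. Then the generalized coherent state transform identity holds: exp(−sy²/2)·exp(iπNτy²)·(2πσ)^{−1/2} ∫_ℝ exp(−((x + isy/(2πN)) − u)²/(2σ))·θ_{l/N}(N(u+τy), Nτ) du = θ_{l/N}(N·z_s, N·τ_s)·exp(iπNτ_s·y²). (The integrand extends to an entire function of the shifted variable, and the integral converges absolutely.) -/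
open scoped BigOperators
open MeasureTheory

lemma gauss_avg (σ : ℝ) (hσ : 0 < σ) (X B A : ℂ) :
    Integrable (fun u : ℝ => Complex.exp (-(X - (u : ℂ)) ^ 2 / (2 * σ)) * Complex.exp (A + B * u)) ∧
    ((Real.sqrt (2 * Real.pi * σ) : ℂ))⁻¹ *
      ∫ u : ℝ, Complex.exp (-(X - (u : ℂ)) ^ 2 / (2 * σ)) * Complex.exp (A + B * u) =
      Complex.exp (A + B * X + σ * B ^ 2 / 2) := by
  have hσ' : (σ : ℂ) ≠ 0 := by exact_mod_cast hσ.ne'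
  have hb : ((-(1 / (2 * σ)) : ℝ) : ℂ).re < 0 := by
    rw [Complex.ofReal_re]
    have : 0 < 1 / (2 * σ) := by positivity
    linarith
  have heq : (fun u : ℝ => Complex.exp (-(X - (u : ℂ)) ^ 2 / (2 * σ)) * Complex.exp (A + B * u)) =
      fun u : ℝ => Complex.exp (((-(1 / (2 * σ)) : ℝ) : ℂ) * u ^ 2 + (X / σ + B) * u +
        (A - X ^ 2 / (2 * σ))) := by
    funext u
    rw [← Complex.exp_add]
    congr 1
    push_cast
    field_simp
    ring
  rw [heq]
  refine ⟨integrable_cexp_quadratic' hb _ _, ?_⟩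
  rw [integral_cexp_quadratic hb]
  have h1 : ((Real.pi : ℂ) / -((-(1 / (2 * σ)) : ℝ) : ℂ)) ^ (1 / 2 : ℂ) =
      (Real.sqrt (2 * Real.pi * σ) : ℂ) := by
    rw [Real.sqrt_eq_rpow, Complex.ofReal_cpow (by positivity)]
    congr 1
    · push_cast
      field_simp
    · push_cast
      rfl
  have h2 : (Real.sqrt (2 * Real.pi * σ) : ℂ) ≠ 0 := by
    have : 0 < Real.sqrt (2 * Real.pi * σ) := Real.sqrt_pos.2 (by positivity)
    exact_mod_cast this.ne'
  rw [h1, inv_mul_cancel_left₀ h2]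
  congr 1
  push_cast
  field_simp
  ring

lemma summable_coef (a : ℝ) (T w : ℂ) (hT : 0 < T.im) :
    Summable (fun n : ℤ => ‖Complex.exp (Real.pi * Complex.I * T * ((n : ℂ) + (a : ℂ)) ^ 2 +
      2 * Real.pi * Complex.I * ((n : ℂ) + (a : ℂ)) * w)‖) := by
  have h := ((summable_jacobiTheta₂_term_iff (T * a + w) T).2 hT).norm.mul_left
    ‖Complex.exp (Real.pi * Complex.I * T * a ^ 2 + 2 * Real.pi * Complex.I * a * w)‖
  refine h.congr fun n => ?_
  rw [← norm_mul, jacobiTheta₂_term, ← Complex.exp_add]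
  congr 2
  ring

/-- The generalized coherent state transform identity for the lowest Landau level on the torus:
the gCST at imaginary time `s` (prefactor `e^{-sy²/2}`, complex shift `x ↦ x + isy/(2πN)`,
heat smoothing with variance `σ = s/(2πN)²`) maps the LLL wavefunction with modular
parameter `τ` to the one with modular parameter `τ_s = τ + is/(2πN)`. -/
theorem stmt_5 (N : ℕ) (hN : 1 ≤ N) (l : ℤ) (τ : ℂ) (hτ : 0 < τ.im) (s : ℝ) (hs : 0 < s)
    (σ : ℝ) (hσ : σ = s / (2 * Real.pi * N) ^ 2)
    (τs : ℂ) (hτs : τs = τ + Complex.I * s / (2 * Real.pi * N)) :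
    ∀ x y : ℝ, ∀ zs : ℂ, zs = (x : ℂ) + τs * (y : ℂ) →
      Complex.exp (-(s * (y : ℂ) ^ 2) / 2) *
        Complex.exp (Real.pi * Complex.I * (N : ℂ) * τ * (y : ℂ) ^ 2) *
        ((Real.sqrt (2 * Real.pi * σ) : ℂ))⁻¹ *
        (∫ u : ℝ, Complex.exp
            (-(((x : ℂ) + Complex.I * s * y / (2 * Real.pi * N)) - (u : ℂ)) ^ 2 / (2 * σ)) *
          jtheta ((l : ℝ) / (N : ℝ)) ((N : ℂ) * ((u : ℂ) + τ * (y : ℂ))) ((N : ℂ) * τ)) =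
      jtheta ((l : ℝ) / (N : ℝ)) ((N : ℂ) * zs) ((N : ℂ) * τs) *
        Complex.exp (Real.pi * Complex.I * (N : ℂ) * τs * (y : ℂ) ^ 2) := by
  intro x y zs hzs
  have hN0 : (0 : ℝ) < N := by exact_mod_cast hN
  have hNc : (N : ℂ) ≠ 0 := by exact_mod_cast hN0.ne'
  have hpi : (Real.pi : ℂ) ≠ 0 := by exact_mod_cast Real.pi_ne_zero
  have hσ0 : 0 < σ := by rw [hσ]; positivity
  have hT : 0 < ((N : ℂ) * τ).im := by
    simp only [Complex.mul_im, Complex.natCast_re, Complex.natCast_im, zero_mul, add_zero]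
    positivity
  set a : ℝ := (l : ℝ) / (N : ℝ) with ha
  set X : ℂ := (x : ℂ) + Complex.I * s * y / (2 * Real.pi * N) with hX
  let A : ℤ → ℂ := fun n => Real.pi * Complex.I * (N * τ) * ((n : ℂ) + (a : ℂ)) ^ 2 +
    2 * Real.pi * Complex.I * ((n : ℂ) + (a : ℂ)) * (N * τ * y)
  let B : ℤ → ℂ := fun n => 2 * Real.pi * Complex.I * ((n : ℂ) + (a : ℂ)) * N
  let F : ℤ → ℝ → ℂ := fun n u =>
    Complex.exp (-(X - (u : ℂ)) ^ 2 / (2 * σ)) * Complex.exp (A n + B n * u)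
  have hF : ∀ n, Integrable (F n) := fun n => (gauss_avg σ hσ0 X (B n) (A n)).1
  have hnorm : ∀ n (u : ℝ), ‖F n u‖ =
      ‖Complex.exp (A n)‖ * ‖Complex.exp (-(X - (u : ℂ)) ^ 2 / (2 * σ))‖ := by
    intro n u
    have : B n * u = ((2 * Real.pi * (n + a) * N * u : ℝ) : ℂ) * Complex.I := by
      simp only [B]; push_cast; ring
    simp only [F]
    rw [norm_mul, Complex.exp_add, norm_mul, this, Complex.norm_exp_ofReal_mul_I]
    ring
  have hsum : Summable fun n => ∫ u, ‖F n u‖ := by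
    simp_rw [hnorm, integral_const_mul]
    exact (summable_coef a (N * τ) (N * τ * y) hT).mul_right _
  have hint : (∫ u : ℝ, Complex.exp (-(X - (u : ℂ)) ^ 2 / (2 * σ)) *
      jtheta a ((N : ℂ) * ((u : ℂ) + τ * (y : ℂ))) ((N : ℂ) * τ)) = ∑' n, ∫ u, F n u := by
    rw [integral_tsum_of_summable_integral_norm hF hsum]
    refine integral_congr_ae (Filter.Eventually.of_forall fun u => ?_)
    simp only [F, jtheta]
    rw [tsum_mul_left]
    congr 1
    refine tsum_congr fun n => ?_
    congr 1
    simp only [A, B]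
    ring
  rw [hint, mul_assoc, ← tsum_mul_left, ← Complex.exp_add, mul_comm]
  congr 1
  · rw [jtheta]
    refine tsum_congr fun n => ?_
    rw [(gauss_avg σ hσ0 X (B n) (A n)).2]
    congr 1
    simp only [A, B]
    rw [hzs, hτs, hσ, hX]
    push_cast
    field_simp
    ring_nf
    try simp only [Complex.I_sq]
    try ring
  · congr 1
    rw [hτs]
    field_simp
    ring_nf
    simp only [Complex.I_sq]
    ring
end

section
/- Let N ≥ 1 be an integer and τ ∈ ℂ with Im τ > 0. For x_j, y_j ∈ ℝ set z_j := x_j + τy_j (j = 1,…,N), Z := Σ_{j=1}^N z_j, and define the fully filled lowest-Landau-level wavefunction Ψ(x₁,y₁,…,x_N,y_N) := ϑ[(N−1)/2, (N−1)/2](Z, τ)·∏_{1≤i<j≤N} θ₁₁(z_i − z_j, τ)·exp(iπτN·Σ_{j=1}^N y_j²). Then for all integers a, b, replacing (x₁, y₁) by (x₁+a, y₁+b) while keeping the remaining variables fixed multiplies Ψ by exp(−2πiNbx₁): Ψ(x₁+a, y₁+b, x₂, y₂, …) = exp(−2πiNbx₁)·Ψ(x₁, y₁, x₂, y₂, …).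 (That is, Ψ transforms in each particle with the unitary multipliers of the degree-N line bundle over the torus ℂ/(ℤ ⊕ τℤ).) -/
open scoped BigOperators

/-- Theta function with characteristics `α, β`:
`ϑ[α,β](w,σ) = Σ_{n∈ℤ} exp(iπσ(n+α)² + 2πi(n+α)(w+β))`. -/
noncomputable def jtheta2 (α β : ℝ) (w σ : ℂ) : ℂ :=
  ∑' n : ℤ, Complex.exp (Real.pi * Complex.I * σ * ((n : ℂ) + (α : ℂ)) ^ 2 +
    2 * Real.pi * Complex.I * ((n : ℂ) + (α : ℂ)) * (w + (β : ℂ)))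

/-- `θ₁₁(w,σ) = ϑ[1/2,1/2](w,σ)`. -/
noncomputable def theta11 (w σ : ℂ) : ℂ := jtheta2 (1/2) (1/2) w σ

/-- The fully filled lowest-Landau-level (IQHE) wavefunction
`Ψ = ϑ[(N−1)/2,(N−1)/2](Z,τ)·∏_{i<j} θ₁₁(z_i − z_j, τ)·e^{iπτN Σ y_j²}`,
with `z_j = x_j + τ y_j` and `Z = Σ z_j`. -/
noncomputable def PsiInteger (N : ℕ) (τ : ℂ) (x y : Fin N → ℝ) : ℂ :=
  jtheta2 (((N : ℝ) - 1) / 2) (((N : ℝ) - 1) / 2)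
      (∑ j, ((x j : ℂ) + τ * (y j : ℂ))) τ *
    (∏ p ∈ Finset.univ.filter (fun p : Fin N × Fin N => p.1 < p.2),
      theta11 (((x p.1 : ℂ) + τ * (y p.1 : ℂ)) - ((x p.2 : ℂ) + τ * (y p.2 : ℂ))) τ) *
    Complex.exp (Real.pi * Complex.I * τ * (N : ℂ) * ∑ j, (y j : ℂ) ^ 2)

lemma jtheta2_shift (α β : ℝ) (w σ : ℂ) (a b : ℤ) :
    jtheta2 α β (w + (a + σ * b)) σ =
      Complex.exp (2 * Real.pi * Complex.I * α * a - Real.pi * Complex.I * b ^ 2 * σ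
        - 2 * Real.pi * Complex.I * b * (w + β)) * jtheta2 α β w σ := by
  unfold jtheta2
  rw [← tsum_mul_left, ← (Equiv.addRight b).tsum_eq (fun n : ℤ => Complex.exp _ * _)]
  refine tsum_congr fun n => ?_
  rw [← Complex.exp_add, Complex.exp_eq_exp_iff_exists_int]
  refine ⟨n * a, ?_⟩
  simp only [Equiv.coe_addRight]
  push_cast
  ring

lemma prod_pairs_succ (m : ℕ) (f : Fin (m + 1) → Fin (m + 1) → ℂ) :
    (∏ p ∈ Finset.univ.filter (fun p : Fin (m + 1) × Fin (m + 1) => p.1 < p.2), f p.1 p.2) =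
      (∏ j : Fin m, f 0 j.succ) *
      ∏ p ∈ Finset.univ.filter (fun p : Fin m × Fin m => p.1 < p.2), f p.1.succ p.2.succ := by
  rw [Finset.prod_filter, Finset.prod_filter, ← Finset.univ_product_univ,
    ← Finset.univ_product_univ, Finset.prod_product, Finset.prod_product]
  simp [Fin.prod_univ_succ]

/-- Translating the first particle by a lattice vector `a + bτ` multiplies the IQHE
wavefunction by the unitary multiplier `e^{−2πiNbx₁}` of the degree-`N` line bundle. -/
theorem stmt_9 (N : ℕ) (hN : 0 < N) (τ : ℂ) (hτ : 0 < τ.im) :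
    ∀ (a b : ℤ) (x y : Fin N → ℝ),
      PsiInteger N τ (Function.update x ⟨0, hN⟩ (x ⟨0, hN⟩ + a))
          (Function.update y ⟨0, hN⟩ (y ⟨0, hN⟩ + b)) =
        Complex.exp (-2 * Real.pi * Complex.I * (N : ℂ) * (b : ℂ) * (x ⟨0, hN⟩ : ℂ)) *
          PsiInteger N τ x y := by
  intro a b x y
  obtain ⟨m, rfl⟩ : ∃ m, N = m + 1 := ⟨N - 1, by omega⟩
  have h0 : (⟨0, hN⟩ : Fin (m + 1)) = 0 := rfl
  rw [h0]
  unfold PsiInteger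
  rw [prod_pairs_succ m (fun i j => theta11 (((x i : ℂ) + τ * (y i : ℂ)) -
      ((x j : ℂ) + τ * (y j : ℂ))) τ),
    prod_pairs_succ m (fun i j => theta11
      (((Function.update x 0 (x 0 + a) i : ℝ) + τ * (Function.update y 0 (y 0 + b) i : ℝ)) -
      ((Function.update x 0 (x 0 + a) j : ℝ) +
        τ * (Function.update y 0 (y 0 + b) j : ℝ))) τ)]
  simp only [Fin.sum_univ_succ, Function.update_self, ne_eq, Fin.succ_ne_zero,
    not_false_eq_true, Function.update_of_ne]
  set S : ℂ := ∑ j : Fin m, ((x j.succ : ℂ) + τ * (y j.succ : ℂ)) with hS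
  have e1 : (((x 0 + a : ℝ) : ℂ) + τ * ((y 0 + b : ℝ) : ℂ) + S) =
      ((x 0 : ℂ) + τ * (y 0 : ℂ) + S) + (a + τ * b) := by push_cast; ring
  have e2 : ∀ j : Fin m, theta11 (((x 0 + a : ℝ) : ℂ) + τ * ((y 0 + b : ℝ) : ℂ) -
      ((x j.succ : ℂ) + τ * (y j.succ : ℂ))) τ =
      Complex.exp (Real.pi * Complex.I * a - Real.pi * Complex.I * b ^ 2 * τ
        - 2 * Real.pi * Complex.I * b * ((x 0 : ℂ) + τ * (y 0 : ℂ) + 1 / 2)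
        + 2 * Real.pi * Complex.I * b * ((x j.succ : ℂ) + τ * (y j.succ : ℂ))) *
      theta11 ((x 0 : ℂ) + τ * (y 0 : ℂ) - ((x j.succ : ℂ) + τ * (y j.succ : ℂ))) τ := by
    intro j
    have e3 : ((x 0 + a : ℝ) : ℂ) + τ * ((y 0 + b : ℝ) : ℂ) -
      ((x j.succ : ℂ) + τ * (y j.succ : ℂ)) = ((x 0 : ℂ) + τ * (y 0 : ℂ) -
      ((x j.succ : ℂ) + τ * (y j.succ : ℂ))) + (a + τ * b) := by push_cast; ring
    unfold theta11
    rw [e3, jtheta2_shift]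
    congr 2
    push_cast
    ring
  rw [e1, jtheta2_shift, Finset.prod_congr rfl (fun j _ => e2 j), Finset.prod_mul_distrib,
    ← Complex.exp_sum, Finset.sum_add_distrib, ← Finset.mul_sum, ← hS]
  simp only [Finset.sum_const, Finset.card_univ, Fintype.card_fin, nsmul_eq_mul]
  generalize (∏ j : Fin m, theta11 _ τ) = P
  generalize (∏ p ∈ _, theta11 _ τ) = Q
  generalize jtheta2 _ _ _ _ = J
  generalize (∑ j : Fin m, (y j.succ : ℂ) ^ 2) = Y
  have key : ∀ A B C D E : ℂ, Complex.exp (A + B + C) = Complex.exp (D + E) →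
      Complex.exp A * J * (Complex.exp B * P * Q) * Complex.exp C =
      Complex.exp D * (J * (P * Q) * Complex.exp E) := by
    intro A B C D E h
    rw [Complex.exp_add, Complex.exp_add, Complex.exp_add] at h
    linear_combination (J * P * Q) * h
  apply key
  rw [Complex.exp_eq_exp_iff_exists_int]
  refine ⟨m * a - m * b, ?_⟩
  push_cast
  ring
end

section
/- Let τ ∈ ℂ with Im τ > 0 and σ > 0. Then for every w ∈ ℂ, Gaussian (heat-kernel) smoothing of θ₁₁ acts as a shift of the modular parameter: (2πσ)^{−1/2} ∫_ℝ exp(−u²/(2σ))·θ₁₁(w + u, τ) du = θ₁₁(w, τ + 2πiσ). (The integral converges absolutely.) -/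
open scoped BigOperators
open MeasureTheory

lemma aux_summable (w τ : ℂ) (hτ : 0 < τ.im) :
    Summable fun n : ℤ => Complex.exp (Real.pi * Complex.I * τ * ((n : ℂ) + ((1/2 : ℝ) : ℂ)) ^ 2 +
    2 * Real.pi * Complex.I * ((n : ℂ) + ((1/2 : ℝ) : ℂ)) * (w + ((1/2 : ℝ) : ℂ))) := by
  have h := ((summable_jacobiTheta₂_term_iff (w + 1/2 + τ/2) τ).2 hτ).mul_left
    (Complex.exp (Real.pi * Complex.I * τ / 4 + Real.pi * Complex.I * (w + 1/2)))
  refine h.congr fun n => ?_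
  rw [jacobiTheta₂_term, ← Complex.exp_add]
  congr 1
  push_cast
  ring

lemma aux_integral (σ : ℝ) (hσ : 0 < σ) (k d : ℂ) :
    ∫ u : ℝ, (Real.exp (-(u ^ 2) / (2 * σ)) : ℂ) *
      Complex.exp (d + 2 * Real.pi * Complex.I * k * u) =
    (Real.sqrt (2 * Real.pi * σ) : ℂ) * Complex.exp (d - 2 * Real.pi ^ 2 * k ^ 2 * σ) := by
  have hσ' : (σ : ℂ) ≠ 0 := by exact_mod_cast hσ.ne'
  have hb : (((-(1 / (2 * σ)) : ℝ)) : ℂ).re < 0 := by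
    rw [Complex.ofReal_re]
    have : 0 < 1 / (2 * σ) := by positivity
    linarith
  have h := integral_cexp_quadratic hb (2 * Real.pi * Complex.I * k) d
  have e1 : (Real.pi / -(((-(1 / (2 * σ)) : ℝ)) : ℂ)) ^ (1 / 2 : ℂ)
      = (Real.sqrt (2 * Real.pi * σ) : ℂ) := by
    rw [Real.sqrt_eq_rpow, Complex.ofReal_cpow (by positivity)]
    push_cast
    congr 1
    field_simp
  have e2 : d - (2 * Real.pi * Complex.I * k) ^ 2 / (4 * (((-(1 / (2 * σ)) : ℝ)) : ℂ))
      = d - 2 * Real.pi ^ 2 * k ^ 2 * σ := by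
    push_cast
    field_simp
    rw [Complex.I_sq]
    ring
  rw [e1, e2] at h
  rw [← h]
  congr 1
  ext u
  rw [Complex.ofReal_exp, ← Complex.exp_add]
  congr 1
  push_cast
  field_simp
  ring

/-- Gaussian (heat-kernel) smoothing of `θ₁₁` acts as a shift of the modular parameter:
`(2πσ)^{-1/2} ∫_ℝ e^{-u²/(2σ)} θ₁₁(w+u, τ) du = θ₁₁(w, τ + 2πiσ)`. -/
theorem stmt_12 (τ : ℂ) (hτ : 0 < τ.im) (σ : ℝ) (hσ : 0 < σ) :
    ∀ w : ℂ,
      ((Real.sqrt (2 * Real.pi * σ) : ℂ))⁻¹ *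
        ∫ u : ℝ, (Real.exp (-(u ^ 2) / (2 * σ)) : ℂ) * theta11 (w + (u : ℂ)) τ =
      theta11 w (τ + 2 * Real.pi * Complex.I * (σ : ℂ)) := by
  intro w
  have hs : (Real.sqrt (2 * Real.pi * σ) : ℂ) ≠ 0 := by
    have : 0 < Real.sqrt (2 * Real.pi * σ) := by positivity
    exact_mod_cast this.ne'
  rw [inv_mul_eq_iff_eq_mul₀ hs]
  set c : ℤ → ℂ := fun n => Real.pi * Complex.I * τ * ((n : ℂ) + ((1/2 : ℝ) : ℂ)) ^ 2 +
    2 * Real.pi * Complex.I * ((n : ℂ) + ((1/2 : ℝ) : ℂ)) * (w + ((1/2 : ℝ) : ℂ)) with hc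
  set F : ℤ → ℝ → ℂ := fun n u => (Real.exp (-(u ^ 2) / (2 * σ)) : ℂ) *
      Complex.exp (c n + 2 * Real.pi * Complex.I * ((n : ℂ) + ((1/2 : ℝ) : ℂ)) * u) with hF
  have hg : Integrable (fun u : ℝ => Real.exp (-(u ^ 2) / (2 * σ))) := by
    have := integrable_exp_neg_mul_sq (b := 1 / (2 * σ)) (by positivity)
    refine this.congr (Filter.Eventually.of_forall fun u => ?_)
    simp only
    congr 1
    ring
  have hnorm : ∀ n u, ‖F n u‖ = Real.exp (-(u ^ 2) / (2 * σ)) * ‖Complex.exp (c n)‖ := by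
    intro n u
    simp only [hF]
    rw [norm_mul, Complex.norm_real, Real.norm_of_nonneg (Real.exp_pos _).le, Complex.exp_add,
      norm_mul]
    have : 2 * Real.pi * Complex.I * ((n : ℂ) + ((1/2 : ℝ) : ℂ)) * u
      = ((2 * Real.pi * ((n : ℝ) + 1/2) * u : ℝ) : ℂ) * Complex.I := by
      push_cast
      ring
    rw [this, Complex.norm_exp_ofReal_mul_I, mul_one]
  have hFi : ∀ n, Integrable (F n) := by
    intro n
    refine (hg.mul_const ‖Complex.exp (c n)‖).mono' ?_
      (Filter.Eventually.of_forall fun u => (hnorm n u).le)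
    apply Continuous.aestronglyMeasurable
    simp only [hF]
    fun_prop
  have hsum : Summable fun n => ∫ u, ‖F n u‖ := by
    simp_rw [hnorm, integral_mul_const]
    exact (aux_summable w τ hτ).norm.mul_left _
  have key := integral_tsum_of_summable_integral_norm hFi hsum
  have e1 : ∀ u : ℝ, (Real.exp (-(u ^ 2) / (2 * σ)) : ℂ) * theta11 (w + (u : ℂ)) τ
      = ∑' n, F n u := by
    intro u
    rw [theta11, jtheta2, ← tsum_mul_left]
    refine tsum_congr fun n => ?_
    simp only [hF, hc]
    congr 2
    ring
  simp_rw [e1]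
  rw [← key, theta11, jtheta2, ← tsum_mul_left]
  refine tsum_congr fun n => ?_
  simp only [hF]
  rw [aux_integral σ hσ]
  congr 2
  simp only [hc]
  linear_combination (-2 * Real.pi ^ 2 * σ * ((n : ℂ) + ((1/2 : ℝ) : ℂ)) ^ 2) * Complex.I_sq
end

section
/- Let k ≥ 1 and N_e ≥ 1 be integers and τ ∈ ℂ with Im τ > 0. Suppose f : ℂ → ℂ is entire and satisfies, for all integers a, b and all Z ∈ ℂ, the quasi-periodicity condition f(Z + a + bτ) = (−1)^{(N_e−1)(a+b)}·exp(−iπkτb² − 2πikbZ)·f(Z). Then f is a linear combination of the k functions Z ↦ ϑ[(N_e−1)/(2k) + l/k, (N_e−1)/2](kZ, kτ) for l = 0,…,k−1; that is, there exist c₀,…,c_{k−1} ∈ ℂ such that f(Z) = Σ_{l=0}^{k−1} c_l·ϑ[(N_e−1)/(2k) + l/k, (N_e−1)/2](kZ, kτ) for all Z ∈ ℂ. (The space of such entire functions is exactly k-dimensional, giving the k-fold degeneracy of the Laughlin states on the torus.) -/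
open scoped BigOperators

open Complex in
lemma aux_shift (g : ℂ → ℂ) (hg : Differentiable ℂ g) (hp : ∀ w, g (w + 1) = g w) (z : ℂ) :
    ∫ x in (0:ℝ)..1, g (z + x) = ∫ x in (0:ℝ)..1, g x := by
  obtain ⟨H, hH⟩ := hg.isExactOn_univ
  have hH' : ∀ w, HasDerivAt H (g w) w := fun w => hH w (Set.mem_univ w)
  have key : ∀ z : ℂ, ∫ x in (0:ℝ)..1, g (z + x) = H (z + 1) - H z := by
    intro z
    have := intervalIntegral.integral_eq_sub_of_hasDerivAt (a := 0) (b := 1)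
      (f := fun x : ℝ => H (z + x)) (f' := fun x : ℝ => g (z + x)) ?_ ?_
    · simpa using this
    · intro x _
      have h1 : HasDerivAt (fun w : ℂ => H (z + w)) (g (z + x)) (x : ℂ) :=
        HasDerivAt.comp_const_add z (x : ℂ) (hH' _)
      exact h1.comp_ofReal
    · apply Continuous.intervalIntegrable
      exact hg.continuous.comp (by fun_prop)
  have hd : ∀ w, HasDerivAt (fun w => H (w + 1) - H w) 0 w := by
    intro w
    have h1 := (HasDerivAt.comp_add_const w 1 (hH' (w + 1))).sub (hH' w)
    rw [hp, sub_self] at h1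
    exact h1
  have hc := is_const_of_deriv_eq_zero (fun w => (hd w).differentiableAt) (fun w => (hd w).deriv) z 0
  have k0 := key 0
  simp only [zero_add] at k0 hc
  rw [key z, k0, hc]

open Complex in
lemma aux_fourier (g : ℂ → ℂ) (hg : Differentiable ℂ g) (hp : ∀ w, g (w + 1) = g w)
    (A : ℤ → ℂ) (hA : ∀ n, A n = ∫ x in (0:ℝ)..1, g x * exp (-(2 * Real.pi * I * n * x)))
    (z : ℂ) (hs : Summable fun n : ℤ => A n * exp (2 * Real.pi * I * n * z)) :
    HasSum (fun n : ℤ => A n * exp (2 * Real.pi * I * n * z)) (g z) := by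
  have : Fact ((0:ℝ) < 1) := ⟨one_pos⟩
  have hper : Function.Periodic (fun x : ℝ => g (z + x)) 1 := by
    intro x
    have := hp (z + x)
    simpa [add_assoc] using this
  have hcont : Continuous (fun x : ℝ => g (z + x)) := hg.continuous.comp (by fun_prop)
  let F : C(AddCircle (1:ℝ), ℂ) := ⟨hper.lift, continuous_coinduced_dom.mpr hcont⟩
  have hF : ∀ x : ℝ, F (x : AddCircle (1:ℝ)) = g (z + x) := fun x => rfl
  have hco : fourierCoeff F = fun n : ℤ => A n * exp (2 * Real.pi * I * n * z) := by
    ext n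
    rw [fourierCoeff_eq_intervalIntegral F n 0]
    have h1 := aux_shift (fun w => g w * exp (-(2 * Real.pi * I * n * w))) (by fun_prop) (by
      intro w
      simp only [hp]
      congr 1
      rw [exp_eq_exp_iff_exists_int]
      exact ⟨-n, by push_cast; ring⟩) z
    rw [hA, ← h1, ← intervalIntegral.integral_mul_const]
    simp only [zero_add, div_one, one_smul]
    congr 1
    ext x
    rw [hF, fourier_coe_apply, smul_eq_mul, mul_comm, mul_assoc (g _), ← exp_add]
    congr 2
    push_cast
    ring
  have := has_pointwise_sum_fourier_series_of_summable (f := F) (by rw [hco]; exact hs)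
    ((0:ℝ) : AddCircle (1:ℝ))
  rw [hF, hco] at this
  simpa using this

lemma aux_neg_one (j : ℤ) : (-1 : ℂ) ^ j = Complex.exp (Real.pi * Complex.I * j) := by
  rw [mul_comm, Complex.exp_int_mul, Complex.exp_pi_mul_I]

/-- An entire function satisfying the center-of-mass quasi-periodicity condition of the
Laughlin wavefunction at level `k` is a linear combination of the `k` theta functions
`Z ↦ ϑ[(N_e−1)/(2k)+l/k, (N_e−1)/2](kZ, kτ)`, `l = 0,…,k−1`: the space of such functions
is `k`-dimensional, giving the `k`-fold degeneracy of the Laughlin states on the torus. -/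
theorem stmt_14 (k Ne : ℕ) (hk : 1 ≤ k) (hNe : 1 ≤ Ne) (τ : ℂ) (hτ : 0 < τ.im)
    (f : ℂ → ℂ) (hf : Differentiable ℂ f)
    (hq : ∀ (a b : ℤ) (Z : ℂ),
      f (Z + (a : ℂ) + (b : ℂ) * τ) =
        (-1 : ℂ) ^ (((Ne : ℤ) - 1) * (a + b)) *
          Complex.exp (-Real.pi * Complex.I * (k : ℂ) * τ * (b : ℂ) ^ 2 -
            2 * Real.pi * Complex.I * (k : ℂ) * (b : ℂ) * Z) * f Z) :
    ∃ c : ℕ → ℂ, ∀ Z : ℂ,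
      f Z = ∑ l ∈ Finset.range k,
        c l * jtheta2 (((Ne : ℝ) - 1) / (2 * k) + (l : ℝ) / k) (((Ne : ℝ) - 1) / 2)
          ((k : ℂ) * Z) ((k : ℂ) * τ) := by
  classical

  have : NeZero k := ⟨by omega⟩
  have hk0 : (k : ℂ) ≠ 0 := by exact_mod_cast (NeZero.ne k)
  set M : ℂ := (Ne : ℂ) - 1 with hM
  have hf1 : ∀ w, f (w + 1) = Complex.exp (Real.pi * Complex.I * M) * f w := by
    intro w
    have := hq 1 0 w
    rw [aux_neg_one] at this
    simpa [hM] using this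
  have hfb : ∀ (m : ℤ) w, f (m * τ + w) = Complex.exp (Real.pi * Complex.I * M * m
      - Real.pi * Complex.I * k * τ * m ^ 2 - 2 * Real.pi * Complex.I * k * m * w) * f w := by
    intro m w
    have := hq 0 m w
    rw [aux_neg_one, ← Complex.exp_add] at this
    rw [add_comm]
    simp only [Int.cast_zero, add_zero] at this
    rw [this]
    congr 2
    push_cast [hM]
    ring
  let h : ℤ → ℂ → ℂ := fun n w => f w * Complex.exp (-(2 * Real.pi * Complex.I * (n + M / 2) * w))
  have hhd : ∀ n, Differentiable ℂ (h n) := fun n => by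
    simp only [h]; fun_prop
  have hhp : ∀ n w, h n (w + 1) = h n w := by
    intro n w
    simp only [h]
    rw [hf1, mul_comm (Complex.exp _) (f w), mul_assoc, ← Complex.exp_add]
    congr 1
    rw [Complex.exp_eq_exp_iff_exists_int]
    exact ⟨-n, by push_cast; ring⟩
  let A : ℤ → ℂ := fun n => ∫ x in (0:ℝ)..1, h n x
  have hA : ∀ (l m : ℤ), A (m * k + l) = Complex.exp (-(Real.pi * Complex.I * M * m) + Real.pi * Complex.I * k * τ * m ^ 2
      + 2 * Real.pi * Complex.I * (l + M / 2) * m * τ) * A l := by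
    intro l m
    simp only [A]
    rw [← aux_shift (h l) (hhd l) (hhp l) (m * τ), ← intervalIntegral.integral_const_mul]
    congr 1
    ext x
    simp only [h]
    rw [hfb, mul_comm (Complex.exp _) (f x), mul_assoc (f _), mul_left_comm (Complex.exp _) (f _), ← Complex.exp_add, ← Complex.exp_add]
    congr 2
    push_cast
    ring
  let T : ℕ → ℂ → ℤ → ℂ := fun l Z n => 
    Complex.exp (Real.pi * Complex.I * (k * τ) * ((n : ℂ) + ((((Ne : ℝ) - 1) / (2 * k) + (l : ℝ) / k : ℝ) : ℂ)) ^ 2 +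
    2 * Real.pi * Complex.I * ((n : ℂ) + ((((Ne : ℝ) - 1) / (2 * k) + (l : ℝ) / k : ℝ) : ℂ)) *
      (k * Z + ((((Ne : ℝ) - 1) / 2 : ℝ) : ℂ)))
  have hT : ∀ l Z, Summable (T l Z) := by
    intro l Z
    have him : 0 < ((k : ℂ) * τ).im := by
      rw [← Complex.ofReal_natCast, Complex.im_ofReal_mul]
      have : (0:ℝ) < k := by exact_mod_cast hk
      positivity
    simp only [T]
    generalize ((((Ne : ℝ) - 1) / (2 * k) + (l : ℝ) / k : ℝ) : ℂ) = α
    generalize (k * Z + ((((Ne : ℝ) - 1) / 2 : ℝ) : ℂ)) = w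
    have h1 := ((summable_jacobiTheta₂_term_iff (w + k * τ * α) (k * τ)).mpr him).mul_left
      (Complex.exp (Real.pi * Complex.I * (k * τ) * α ^ 2 + 2 * Real.pi * Complex.I * α * w))
    refine h1.congr fun n => ?_
    rw [jacobiTheta₂_term, ← Complex.exp_add]
    congr 1
    ring
  let c : ℕ → ℂ := fun l => A l * Complex.exp (-(Real.pi * Complex.I * τ * (l + M / 2) ^ 2 / k)
    - Real.pi * Complex.I * M * ((l + M / 2) / k))
  have hc : ∀ (l : ℕ) (m : ℤ) Z, A (m * k + l) * Complex.exp (2 * Real.pi * Complex.I * ((m * k + l : ℤ) : ℂ) * Z)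
      = Complex.exp (-(Real.pi * Complex.I * M * Z)) * (c l * T l Z m) := by
    intro l m Z
    have e : Complex.exp (-(Real.pi * Complex.I * M * m)) = Complex.exp (Real.pi * Complex.I * M * m) := by
      rw [Complex.exp_eq_exp_iff_exists_int]
      exact ⟨-((Ne - 1) * m), by push_cast [hM]; ring⟩
    rw [hA, add_assoc, Complex.exp_add, e]
    simp only [c, T]
    rw [mul_comm _ (A l), mul_assoc (A l), mul_assoc (A l), mul_left_comm _ (A l), ← Complex.exp_add, ← Complex.exp_add,
      ← Complex.exp_add, ← Complex.exp_add]
    congr 2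
    push_cast
    rw [← hM]
    field_simp
    ring
  refine ⟨c, fun Z => ?_⟩
  have hsp : Summable fun p : Fin k × ℤ => c p.1 * T p.1 Z p.2 := by
    apply Summable.of_norm
    rw [summable_prod_of_nonneg (fun _ => norm_nonneg _)]
    exact ⟨fun l => ((hT l Z).mul_left (c l)).norm, (hasSum_fintype _).summable⟩
  let e : Fin k × ℤ ≃ ℤ := (Equiv.prodComm _ _).trans (Int.divModEquiv k).symm
  have he : ∀ p : Fin k × ℤ, e p = p.2 * k + (p.1 : ℕ) := fun p => by simp [e]
  have hs2 : Summable fun n : ℤ => A n * Complex.exp (2 * Real.pi * Complex.I * n * Z) := by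
    rw [← e.summable_iff]
    refine (hsp.mul_left (Complex.exp (-(Real.pi * Complex.I * M * Z)))).congr fun p => ?_
    rw [Function.comp_apply, he, hc]
  have hsum := aux_fourier (h 0) (hhd 0) (hhp 0) A (fun n => by
    simp only [A, h]
    congr 1
    ext x
    rw [mul_assoc (f _), ← Complex.exp_add]
    congr 2
    push_cast
    ring) Z hs2
  rw [← e.hasSum_iff] at hsum
  have hsum2 := hsum.mul_left (Complex.exp (Real.pi * Complex.I * M * Z))
  have e1 : Complex.exp (Real.pi * Complex.I * M * Z) * h 0 Z = f Z := by
    simp only [h]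
    rw [mul_left_comm, ← Complex.exp_add]
    have : (Real.pi * Complex.I * M * Z + -(2 * Real.pi * Complex.I * (((0:ℤ):ℂ) + M / 2) * Z)) = 0 := by
      push_cast; ring
    rw [this, Complex.exp_zero, mul_one]
  have e2 : (fun p : Fin k × ℤ => Complex.exp (Real.pi * Complex.I * M * Z) *
      ((fun n : ℤ => A n * Complex.exp (2 * Real.pi * Complex.I * n * Z)) ∘ e) p)
      = fun p : Fin k × ℤ => c p.1 * T p.1 Z p.2 := by
    ext p
    rw [Function.comp_apply, he, hc, ← mul_assoc, ← Complex.exp_add, add_neg_cancel, Complex.exp_zero, one_mul]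
  rw [e1, e2] at hsum2
  have hfin := (hsum2.prod_fiberwise fun l => ((hT l Z).mul_left (c l)).hasSum)
  have := hfin.unique (hasSum_fintype _)
  rw [this, Finset.sum_range]
  refine Finset.sum_congr rfl fun l _ => ?_
  rw [tsum_mul_left]
  rfl
end

section
/- Let s > 0 and let f : ℝ → ℂ be of the form f(u) = P(u)·exp(−u²/(2s)) for a polynomial P with complex coefficients. Then the heat transform at time s intertwines the creation operator u − s·d/du with multiplication by the complex variable: for every z ∈ ℂ, (2πs)^{−1/2} ∫_ℝ exp(−(z−u)²/(2s))·(u·f(u) − s·f′(u)) du = z · (2πs)^{−1/2} ∫_ℝ exp(−(z−u)²/(2s))·f(u) du. (Both integrals converge absolutely.) -/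
open scoped BigOperators
open MeasureTheory

lemma aux_int_mono (b c d : ℂ) (hb : b.re < 0) (n : ℕ) :
    Integrable (fun u : ℝ => (u : ℂ) ^ n * Complex.exp (b * u ^ 2 + c * u + d)) := by
  have h1 := (integrable_cexp_quadratic' hb (c + 1) d).norm
  have h2 := (integrable_cexp_quadratic' hb (c - 1) d).norm
  refine Integrable.mono' ((h1.add h2).const_mul (n.factorial : ℝ)) ?_ ?_
  · exact Continuous.aestronglyMeasurable (by fun_prop)
  · refine Filter.Eventually.of_forall fun u => ?_
    have e1 : b * (u : ℂ) ^ 2 + (c + 1) * u + d = (b * u ^ 2 + c * u + d) + (u : ℂ) := by ring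
    have e2 : b * (u : ℂ) ^ 2 + (c - 1) * u + d = (b * u ^ 2 + c * u + d) + ((-u : ℝ) : ℂ) := by
      push_cast; ring
    simp only [Pi.add_apply]
    rw [e1, e2]
    generalize b * (u : ℂ) ^ 2 + c * u + d = q
    rw [Complex.exp_add, Complex.exp_add, norm_mul, norm_mul, norm_mul, norm_pow,
      Complex.norm_real, ← Complex.ofReal_exp, ← Complex.ofReal_exp, Complex.norm_real,
      Complex.norm_real, Real.norm_eq_abs, Real.norm_eq_abs, Real.norm_eq_abs,
      Real.abs_exp, Real.abs_exp]
    have h3 := Real.pow_div_factorial_le_exp |u| (abs_nonneg u) n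
    have h4 : Real.exp |u| ≤ Real.exp u + Real.exp (-u) := by
      rcases abs_cases u with ⟨h, _⟩ | ⟨h, _⟩ <;> rw [h] <;>
        linarith [Real.exp_pos u, Real.exp_pos (-u)]
    have hn : (0 : ℝ) < n.factorial := by exact_mod_cast n.factorial_pos
    rw [div_le_iff₀ hn] at h3
    have h5 : |u| ^ n ≤ n.factorial * (Real.exp u + Real.exp (-u)) := by nlinarith
    have := mul_le_mul_of_nonneg_right h5
      (norm_nonneg (Complex.exp q))
    linarith

lemma aux_int_poly (b c d : ℂ) (hb : b.re < 0) (P : Polynomial ℂ) :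
    Integrable (fun u : ℝ => P.eval (u : ℂ) * Complex.exp (b * u ^ 2 + c * u + d)) := by
  induction P using Polynomial.induction_on' with
  | add p q hp hq =>
    simp only [Polynomial.eval_add, add_mul]
    exact hp.add hq
  | monomial n a =>
    simp only [Polynomial.eval_monomial, mul_assoc]
    exact (aux_int_mono b c d hb n).const_mul a

/-- The heat transform at time `s` intertwines the creation operator `u − s·d/du`
with multiplication by the complex variable `z`, on functions of the form
(polynomial)·(Gaussian of variance s). -/
theorem stmt_15 (s : ℝ) (hs : 0 < s) (P : Polynomial ℂ) (f : ℝ → ℂ)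
    (hf : ∀ u : ℝ, f u = P.eval (u : ℂ) * Real.exp (-(u ^ 2) / (2 * s))) :
    ∀ z : ℂ,
      ((Real.sqrt (2 * Real.pi * s) : ℂ))⁻¹ *
        (∫ u : ℝ, Complex.exp (-(z - (u : ℂ)) ^ 2 / (2 * s)) *
          ((u : ℂ) * f u - (s : ℂ) * deriv f u)) =
      z * (((Real.sqrt (2 * Real.pi * s) : ℂ))⁻¹ *
        ∫ u : ℝ, Complex.exp (-(z - (u : ℂ)) ^ 2 / (2 * s)) * f u) := by
  intro z
  have hs' : (s : ℂ) ≠ 0 := by exact_mod_cast hs.ne'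
  have hb : (-(s : ℂ)⁻¹).re < 0 := by
    rw [← Complex.ofReal_inv, Complex.neg_re, Complex.ofReal_re]
    have := inv_pos.mpr hs
    linarith
  set E : ℝ → ℂ := fun u =>
    Complex.exp (-(s : ℂ)⁻¹ * u ^ 2 + z / s * u + -z ^ 2 / (2 * s)) with hE
  set g : ℝ → ℂ := fun u => Complex.exp (-(z - (u : ℂ)) ^ 2 / (2 * s)) with hg
  have hgf : ∀ u : ℝ, g u * f u = P.eval (u : ℂ) * E u := by
    intro u
    rw [hf, Complex.ofReal_exp, mul_left_comm]
    simp only [hg, hE]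
    rw [← Complex.exp_add]
    congr 2
    push_cast
    field_simp
    ring
  have hI : Integrable (fun u => g u * f u) := by
    simp only [hgf]
    exact aux_int_poly _ _ _ hb P
  -- derivative of the Gaussian kernel
  have hg' : ∀ u : ℝ, HasDerivAt g ((z - u) / s * g u) u := by
    intro u
    have h0 : HasDerivAt (fun u : ℝ => (u : ℂ)) 1 u := Complex.ofRealCLM.hasDerivAt
    have h1 := (((h0.const_sub z).fun_pow 2).fun_neg.div_const (2 * (s : ℂ))).cexp
    convert h1 using 1
    simp only [hg]
    push_cast
    field_simp
  have hf' : ∀ u : ℝ, HasDerivAt f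
      ((P.derivative.eval (u : ℂ) - u / s * P.eval (u : ℂ)) *
        Real.exp (-(u ^ 2) / (2 * s))) u := by
    intro u
    have h0 : HasDerivAt (fun u : ℝ => (u : ℂ)) 1 u := Complex.ofRealCLM.hasDerivAt
    have hP : HasDerivAt (fun u : ℝ => P.eval (u : ℂ)) (P.derivative.eval (u : ℂ)) u :=
      (P.hasDerivAt (u : ℂ)).comp_ofReal
    have h1 := ((h0.fun_pow 2).fun_neg.div_const (2 * (s : ℂ))).cexp
    have h2 := hP.mul h1
    have : f = (fun u : ℝ => P.eval (u : ℂ)) *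
        (fun u : ℝ => Complex.exp (-(u : ℂ) ^ 2 / (2 * (s : ℂ)))) := by
      funext u
      simp [hf]
    rw [this]
    refine HasDerivAt.congr_deriv h2 ?_
    push_cast
    field_simp
    ring
  have hK : ∀ u : ℝ, HasDerivAt (fun u => g u * f u)
      ((z - u) / s * g u * f u + g u * deriv f u) u := by
    intro u
    have := (hg' u).mul (hf' u)
    rw [(hf' u).deriv]
    exact this
  have hI' : Integrable (fun u : ℝ => (z - u) / s * g u * f u + g u * deriv f u) := by
    have h := aux_int_poly _ (z / s) (-z ^ 2 / (2 * s)) hb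
      (Polynomial.derivative P + P * (Polynomial.C (z / s) - Polynomial.C (2 / (s : ℂ)) * Polynomial.X))
    refine h.congr (Filter.Eventually.of_forall fun u => ?_)
    have e := hgf u
    rw [hf] at e
    have e2 : g u * (Real.exp (-(u ^ 2) / (2 * s)) : ℂ) = E u := by
      rw [Complex.ofReal_exp]
      simp only [hg, hE]
      rw [← Complex.exp_add]
      congr 1
      push_cast
      field_simp
      ring
    simp only [(hf' u).deriv, hf]
    change _ * E u = _
    rw [← e2]
    simp only [Polynomial.eval_add, Polynomial.eval_mul, Polynomial.eval_sub, Polynomial.eval_C,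
      Polynomial.eval_X]
    field_simp
    ring
  have h0 := integral_eq_zero_of_hasDerivAt_of_integrable hK hI' hI
  have key : ∀ u : ℝ, g u * ((u : ℂ) * f u - s * deriv f u) =
      z * (g u * f u) - s * ((z - u) / s * g u * f u + g u * deriv f u) := by
    intro u
    field_simp
    ring
  change _ * (∫ u : ℝ, g u * ((u : ℂ) * f u - s * deriv f u)) = z * (_ * ∫ u : ℝ, g u * f u)
  simp only [key]
  rw [integral_sub (hI.const_mul z) (hI'.const_mul _), integral_const_mul, integral_const_mul, h0]
  ring
end

section
/- Let s > 0 and define the Hermite-type functions h_m : ℝ → ℂ recursively by h₀(u) := exp(−u²/(2s)) and h_{m+1}(u) := u·h_m(u) − s·h_m′(u) for m ∈ ℕ. Then for every m ∈ ℕ and all x, p ∈ ℝ, with z_s := x + isp, the generalized coherent state transform U_s = e^{−sp²/2} ∘ e^{isp∂_x} ∘ e^{(s/2)∂_x²} maps h_m to a multiple of the m-th holomorphic Landau state of the deformed flat plane geometry; explicitly: e^{−sp²/2} · (2πs)^{−1/2} ∫_ℝ exp(−(z_s − u)²/(2s))·h_m(u) du = 2^{−1/2}·e^{−ixp/2}·z_s^m·exp(−(x²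 + s²p²)/(4s)), where e^{−ixp/2} is a unimodular gauge phase and x² + s²p² = |z_s|². (The integral converges absolutely and the equality holds for all x, p ∈ ℝ.) -/
open scoped BigOperators
open MeasureTheory

theorem aux_int (b c d : ℂ) (hb : b.re < 0) (n : ℕ) :
    Integrable (fun u : ℝ => (u : ℂ) ^ n * Complex.exp (b * (u : ℂ) ^ 2 + c * u + d)) := by
  have h1 := (integrable_cexp_quadratic' hb (c + 1) d).norm
  have h2 := (integrable_cexp_quadratic' hb (c - 1) d).norm
  refine Integrable.mono' ((h1.add h2).const_mul (n.factorial : ℝ)) (by fun_prop) ?_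
  refine Filter.Eventually.of_forall fun u => ?_
  have e1 : Complex.exp (b * (u : ℂ) ^ 2 + (c + 1) * u + d)
      = (Real.exp u : ℂ) * Complex.exp (b * (u : ℂ) ^ 2 + c * u + d) := by
    rw [Complex.ofReal_exp, ← Complex.exp_add]; congr 1; ring
  have e2 : Complex.exp (b * (u : ℂ) ^ 2 + (c - 1) * u + d)
      = (Real.exp (-u) : ℂ) * Complex.exp (b * (u : ℂ) ^ 2 + c * u + d) := by
    rw [Complex.ofReal_exp, ← Complex.exp_add]; congr 1; push_cast; ring
  simp only [Pi.add_apply]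
  rw [e1, e2, norm_mul, norm_mul, norm_mul, norm_pow, Complex.norm_real, Complex.norm_real,
    Complex.norm_real, Real.norm_of_nonneg (Real.exp_pos u).le,
    Real.norm_of_nonneg (Real.exp_pos (-u)).le, ← add_mul, ← mul_assoc]
  refine mul_le_mul_of_nonneg_right ?_ (norm_nonneg _)
  have h3 := Real.pow_div_factorial_le_exp |u| (abs_nonneg u) n
  have hf : (0 : ℝ) < n.factorial := by positivity
  rw [div_le_iff₀ hf] at h3
  have h4 : Real.exp |u| ≤ Real.exp u + Real.exp (-u) := by
    rcases abs_cases u with h | h <;> rw [h.1] <;> linarith [Real.exp_pos u, Real.exp_pos (-u)]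
  rw [Real.norm_eq_abs]
  nlinarith

theorem aux_poly (P : Polynomial ℂ) (s : ℝ) (hs : 0 < s) (z : ℂ) :
    Integrable (fun u : ℝ => Complex.exp (-(z - (u : ℂ)) ^ 2 / (2 * s)) *
      (P.eval (u : ℂ) * Complex.exp (-((u : ℂ) ^ 2) / (2 * s)))) := by
  have hs' : (s : ℂ) ≠ 0 := by exact_mod_cast hs.ne'
  have key : ∀ u : ℝ, Complex.exp (-(z - (u : ℂ)) ^ 2 / (2 * s)) *
      (P.eval (u : ℂ) * Complex.exp (-((u : ℂ) ^ 2) / (2 * s))) =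
      ∑ i ∈ Finset.range (P.natDegree + 1), P.coeff i * ((u : ℂ) ^ i *
        Complex.exp ((-1 / s : ℂ) * (u : ℂ) ^ 2 + (z / s) * u + (-z ^ 2 / (2 * s)))) := by
    intro u
    have : Complex.exp ((-1 / s : ℂ) * (u : ℂ) ^ 2 + (z / s) * u + (-z ^ 2 / (2 * s))) =
        Complex.exp (-(z - (u : ℂ)) ^ 2 / (2 * s)) * Complex.exp (-((u : ℂ) ^ 2) / (2 * s)) := by
      rw [← Complex.exp_add]; congr 1; field_simp; ring
    rw [this, Polynomial.eval_eq_sum_range]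
    simp only [← mul_assoc, ← Finset.sum_mul]
    rw [Finset.mul_sum, Finset.sum_mul, Finset.sum_mul, Finset.sum_mul]
    refine Finset.sum_congr rfl fun i _ => by ring
  simp_rw [key]
  refine integrable_finsetSum _ fun i _ => (aux_int _ _ _ ?_ i).const_mul _
  have : (-1 / s : ℂ) = ((-1 / s : ℝ) : ℂ) := by push_cast; ring
  rw [this, Complex.ofReal_re]
  exact div_neg_of_neg_of_pos (by norm_num) hs

theorem aux_deriv (P : Polynomial ℂ) (s : ℝ) (hs : 0 < s) (u : ℝ) :
    HasDerivAt (fun u : ℝ => P.eval (u : ℂ) * Complex.exp (-((u : ℂ) ^ 2) / (2 * s)))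
      ((P.derivative - Polynomial.C (1 / (s : ℂ)) * Polynomial.X * P).eval (u : ℂ) *
        Complex.exp (-((u : ℂ) ^ 2) / (2 * s))) u := by
  have hs' : (s : ℂ) ≠ 0 := by exact_mod_cast hs.ne'
  have h1 : HasDerivAt (fun w : ℂ => P.eval w * Complex.exp (-(w ^ 2) / (2 * s)))
      (P.derivative.eval (u : ℂ) * Complex.exp (-((u : ℂ) ^ 2) / (2 * s)) +
       P.eval (u : ℂ) * (Complex.exp (-((u : ℂ) ^ 2) / (2 * s)) *
        (-(2 * (u : ℂ)) / (2 * s)))) (u : ℂ) := by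
    have h2 := (((hasDerivAt_pow 2 (u : ℂ)).neg.div_const (2 * (s : ℂ))).cexp)
    refine (P.hasDerivAt (u : ℂ)).mul ?_
    simpa using h2
  convert h1.comp_ofReal using 1
  simp
  field_simp
  ring

theorem aux_form (s : ℝ) (hs : 0 < s) (h : ℕ → ℝ → ℂ)
    (h0 : ∀ u : ℝ, h 0 u = Real.exp (-(u ^ 2) / (2 * s)))
    (hrec : ∀ (m : ℕ) (u : ℝ), h (m + 1) u = (u : ℂ) * h m u - (s : ℂ) * deriv (h m) u)
    (m : ℕ) : ∃ P : Polynomial ℂ, h m =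
      fun u : ℝ => P.eval (u : ℂ) * Complex.exp (-((u : ℂ) ^ 2) / (2 * s)) := by
  induction m with
  | zero => exact ⟨1, by funext u; rw [h0]; simp⟩
  | succ m ih =>
    obtain ⟨P, hP⟩ := ih
    refine ⟨Polynomial.X * P - Polynomial.C (s : ℂ) *
      (P.derivative - Polynomial.C (1 / (s : ℂ)) * Polynomial.X * P), ?_⟩
    funext u
    rw [hrec, hP, (aux_deriv P s hs u).deriv]
    simp only [Polynomial.eval_sub, Polynomial.eval_mul, Polynomial.eval_X, Polynomial.eval_C]
    ring

theorem aux_step (P : Polynomial ℂ) (s : ℝ) (hs : 0 < s) (z : ℂ) (f : ℝ → ℂ)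
    (hf : f = fun u : ℝ => P.eval (u : ℂ) * Complex.exp (-((u : ℂ) ^ 2) / (2 * s))) :
    (∫ u : ℝ, Complex.exp (-(z - (u : ℂ)) ^ 2 / (2 * s)) *
      ((u : ℂ) * f u - (s : ℂ) * deriv f u)) =
    z * ∫ u : ℝ, Complex.exp (-(z - (u : ℂ)) ^ 2 / (2 * s)) * f u := by
  have hs' : (s : ℂ) ≠ 0 := by exact_mod_cast hs.ne'
  have hd : ∀ u, HasDerivAt f (deriv f u) u := fun u => by
    rw [hf]; exact (aux_deriv P s hs u).differentiableAt.hasDerivAt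
  have hG : ∀ u : ℝ, HasDerivAt (fun u : ℝ => Complex.exp (-(z - (u : ℂ)) ^ 2 / (2 * s)))
      ((z - u) / s * Complex.exp (-(z - (u : ℂ)) ^ 2 / (2 * s))) u := by
    intro u
    have h2 := (((((hasDerivAt_id (u : ℂ)).const_sub z).pow 2).neg.div_const
      (2 * (s : ℂ))).cexp).comp_ofReal
    have h3 : HasDerivAt (fun u : ℝ => Complex.exp (-(z - (u : ℂ)) ^ 2 / (2 * s)))
      (Complex.exp (-(z - (u : ℂ)) ^ 2 / (2 * s)) *
      (-(((2 : ℕ) : ℂ) * (z - (u : ℂ)) ^ 1 * -1) / (2 * s))) u := h2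
    convert h3 using 1
    push_cast
    field_simp
  have i1 : Integrable (fun u : ℝ => Complex.exp (-(z - (u : ℂ)) ^ 2 / (2 * s)) * f u) := by
    rw [hf]; exact aux_poly P s hs z
  have i2 : Integrable (fun u : ℝ => Complex.exp (-(z - (u : ℂ)) ^ 2 / (2 * s)) *
      ((u : ℂ) * f u)) := by
    refine (aux_poly (Polynomial.X * P) s hs z).congr (Filter.Eventually.of_forall fun u => ?_)
    simp only [hf, Polynomial.eval_mul, Polynomial.eval_X]
    ring
  have i3 : Integrable (fun u : ℝ => Complex.exp (-(z - (u : ℂ)) ^ 2 / (2 * s)) *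
      deriv f u) := by
    refine (aux_poly (P.derivative - Polynomial.C (1 / (s : ℂ)) * Polynomial.X * P)
      s hs z).congr (Filter.Eventually.of_forall fun u => ?_)
    simp only [hf, (aux_deriv P s hs u).deriv]
  have e4 : ∀ u : ℝ, ((z - u) / s * Complex.exp (-(z - (u : ℂ)) ^ 2 / (2 * s))) * f u =
      (z / s) * (Complex.exp (-(z - (u : ℂ)) ^ 2 / (2 * s)) * f u) -
      (1 / s) * (Complex.exp (-(z - (u : ℂ)) ^ 2 / (2 * s)) * ((u : ℂ) * f u)) := by
    intro u; ring
  have i4 : Integrable (fun u : ℝ =>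
      ((z - u) / s * Complex.exp (-(z - (u : ℂ)) ^ 2 / (2 * s))) * f u) := by
    simp_rw [e4]
    exact (i1.const_mul _).sub (i2.const_mul _)
  have ibp := integral_mul_deriv_eq_deriv_mul_of_integrable (fun u _ => hG u) (fun u _ => hd u)
    i3 i4 i1
  simp_rw [e4] at ibp
  rw [integral_sub (i1.const_mul _) (i2.const_mul _), integral_const_mul,
    integral_const_mul] at ibp
  have e5 : ∀ u : ℝ, Complex.exp (-(z - (u : ℂ)) ^ 2 / (2 * s)) *
      ((u : ℂ) * f u - (s : ℂ) * deriv f u) =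
      Complex.exp (-(z - (u : ℂ)) ^ 2 / (2 * s)) * ((u : ℂ) * f u) -
      s * (Complex.exp (-(z - (u : ℂ)) ^ 2 / (2 * s)) * deriv f u) := by
    intro u; ring
  simp_rw [e5]
  rw [integral_sub i2 (i3.const_mul _), integral_const_mul, ibp]
  field_simp
  ring

theorem aux_zero (s : ℝ) (hs : 0 < s) (z : ℂ) :
    (∫ u : ℝ, Complex.exp (-(z - (u : ℂ)) ^ 2 / (2 * s)) *
      (Real.exp (-(u ^ 2) / (2 * s)) : ℂ)) =
    (Real.sqrt (Real.pi * s) : ℂ) * Complex.exp (-z ^ 2 / (4 * s)) := by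
  have hs' : (s : ℂ) ≠ 0 := by exact_mod_cast hs.ne'
  have hb : (-1 / s : ℂ).re < 0 := by
    have : (-1 / s : ℂ) = ((-1 / s : ℝ) : ℂ) := by push_cast; ring
    rw [this, Complex.ofReal_re]
    exact div_neg_of_neg_of_pos (by norm_num) hs
  have key := integral_cexp_quadratic hb (z / s) (-z ^ 2 / (2 * s))
  have e : ∀ u : ℝ, Complex.exp (-(z - (u : ℂ)) ^ 2 / (2 * s)) *
      (Real.exp (-(u ^ 2) / (2 * s)) : ℂ) =
      Complex.exp ((-1 / s : ℂ) * (u : ℂ) ^ 2 + (z / s) * u + (-z ^ 2 / (2 * s))) := by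
    intro u
    rw [Complex.ofReal_exp, ← Complex.exp_add]; congr 1; push_cast; field_simp; ring
  simp_rw [e]
  rw [key]
  congr 1
  · rw [Real.sqrt_eq_rpow, Complex.ofReal_cpow (by positivity)]
    congr 1
    · push_cast; field_simp
    · push_cast; rfl
  · congr 1; field_simp; ring

/-- The generalized coherent state transform (Segal–Bargmann transform) at imaginary time
`s`, given by `e^{−sp²/2} ∘ e^{isp∂_x} ∘ e^{(s/2)∂_x²}` (Gaussian prefactor, evaluation of
the entire heat extension at `z_s = x + isp`), maps the Hermite-type functions
`h₀(u) = e^{−u²/(2s)}`, `h_{m+1} = u·h_m − s·h_m′` to multiples of the holomorphic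
Landau states `z_s^m e^{−|z_s|²/(4s)}` of the deformed flat plane geometry. -/
theorem stmt_16 (s : ℝ) (hs : 0 < s) (h : ℕ → ℝ → ℂ)
    (h0 : ∀ u : ℝ, h 0 u = Real.exp (-(u ^ 2) / (2 * s)))
    (hrec : ∀ (m : ℕ) (u : ℝ), h (m + 1) u = (u : ℂ) * h m u - (s : ℂ) * deriv (h m) u) :
    ∀ (m : ℕ) (x p : ℝ), ∀ zs : ℂ, zs = (x : ℂ) + Complex.I * (s : ℂ) * (p : ℂ) →
      (Real.exp (-(s * p ^ 2) / 2) : ℂ) * ((Real.sqrt (2 * Real.pi * s) : ℂ))⁻¹ *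
        (∫ u : ℝ, Complex.exp (-(zs - (u : ℂ)) ^ 2 / (2 * s)) * h m u) =
      ((Real.sqrt 2 : ℂ))⁻¹ * Complex.exp (-Complex.I * (x : ℂ) * (p : ℂ) / 2) *
        zs ^ m * (Real.exp (-(x ^ 2 + s ^ 2 * p ^ 2) / (4 * s)) : ℂ) := by
  intro m x p zs hz
  have hs' : (s : ℂ) ≠ 0 := by exact_mod_cast hs.ne'
  have hI : (∫ u : ℝ, Complex.exp (-(zs - (u : ℂ)) ^ 2 / (2 * s)) * h m u) =
      zs ^ m * ((Real.sqrt (Real.pi * s) : ℂ) * Complex.exp (-zs ^ 2 / (4 * s))) := by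
    induction m with
    | zero => simp_rw [h0]; rw [aux_zero s hs zs, pow_zero, one_mul]
    | succ m ih =>
      obtain ⟨P, hP⟩ := aux_form s hs h h0 hrec m
      simp_rw [hrec]
      rw [aux_step P s hs zs (h m) hP, ih]
      ring
  rw [hI]
  have hq : Real.sqrt (2 * Real.pi * s) = Real.sqrt 2 * Real.sqrt (Real.pi * s) := by
    rw [← Real.sqrt_mul (by norm_num), mul_assoc]
  have hq0 : (Real.sqrt (Real.pi * s) : ℂ) ≠ 0 := by
    have : 0 < Real.sqrt (Real.pi * s) := Real.sqrt_pos.mpr (by positivity)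
    exact_mod_cast this.ne'
  have hE : (Real.exp (-(s * p ^ 2) / 2) : ℂ) * Complex.exp (-zs ^ 2 / (4 * s)) =
      Complex.exp (-Complex.I * (x : ℂ) * (p : ℂ) / 2) *
        (Real.exp (-(x ^ 2 + s ^ 2 * p ^ 2) / (4 * s)) : ℂ) := by
    rw [Complex.ofReal_exp, Complex.ofReal_exp, ← Complex.exp_add, ← Complex.exp_add, hz]
    congr 1
    push_cast
    field_simp
    ring_nf
    simp only [Complex.I_sq]
    ring
  rw [hq, Complex.ofReal_mul, mul_inv]
  calc _ = ((Real.sqrt 2 : ℂ))⁻¹ * zs ^ m *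
        ((Real.sqrt (Real.pi * s) : ℂ)⁻¹ * (Real.sqrt (Real.pi * s) : ℂ)) *
        ((Real.exp (-(s * p ^ 2) / 2) : ℂ) * Complex.exp (-zs ^ 2 / (4 * s))) := by ring
    _ = _ := by rw [hE, inv_mul_cancel₀ hq0]; ring
end
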